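/- Let η ∈ ℂ \ {0} and let c1, c2 ∈ ℂ, not both zero, and set f(z) = c1·e^{iηz} + c2·e^{−iηz}. If f has infinitely many real zeros, then η² is a positive real number, and there exist a real number η̃ with η̃² = η², a constant C ∈ ℂ \ {0}, and a real number ω such that f(z) = C·sin(η̃ z − ω) for all z ∈ ℂ. -/

import Mathlib

open Complex Filter Set

/-- If `z ↦ c₁ e^{iηz} + c₂ e^{−iηz}` vanishes at `a`, it is a multiple of `z ↦ sin (η (z - a))`. -/
theorem exp_add_exp_eq_sin_of_zero {η c₁ c₂ a : ℂ}
    (ha : c₁ * exp (I * η * a) + c₂ * exp (-(I * η * a)) = 0) (z : ℂ) :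
    c₁ * exp (I * η * z) + c₂ * exp (-(I * η * z)) =
      2 * I * c₁ * exp (I * η * a) * sin (η * z - η * a) := by
  have h₁ : exp (-(η * z - η * a) * I) = exp (-(I * η * z)) * exp (I * η * a) := by
    rw [← exp_add]; ring_nf
  have h₂ : exp ((η * z - η * a) * I) = exp (I * η * z) * exp (-(I * η * a)) := by
    rw [← exp_add]; ring_nf
  have h₃ : exp (I * η * a) * exp (-(I * η * a)) = 1 := by
    rw [← exp_add, add_neg_cancel, exp_zero]
  rw [sin, h₁, h₂]
  linear_combination (exp (-(I * η * z)) * exp (I * η * a)) * ha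
    - (c₂ * exp (-(I * η * z)) + c₁ * exp (I * η * z)) * h₃
    - c₁ * exp (I * η * a) * (exp (-(I * η * z)) * exp (I * η * a)
      - exp (I * η * z) * exp (-(I * η * a))) * I_sq

/-- Theorem: a nontrivial solution `f(z) = c₁ e^{iηz} + c₂ e^{−iηz}` of `y'' + η² y = 0`
(`η ≠ 0`) with infinitely many real zeros has `η²` a positive real number, and
`f(z) = C sin(η̃ z − ω)` for some real `η̃` with `η̃² = η²`, some `C ≠ 0` and real `ω`. -/
theorem stmt3 (η c₁ c₂ : ℂ) (hη : η ≠ 0) (hc : ¬ (c₁ = 0 ∧ c₂ = 0))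
    (f : ℂ → ℂ)
    (hf : ∀ z : ℂ, f z = c₁ * Complex.exp (Complex.I * η * z) +
      c₂ * Complex.exp (-(Complex.I * η * z)))
    (hzeros : {x : ℝ | f (x : ℂ) = 0}.Infinite) :
    ((η ^ 2).im = 0 ∧ 0 < (η ^ 2).re) ∧
    ∃ (t : ℝ) (C : ℂ) (ω : ℝ), ((t : ℂ)) ^ 2 = η ^ 2 ∧ C ≠ 0 ∧
      ∀ z : ℂ, f z = C * Complex.sin ((t : ℂ) * z - (ω : ℂ)) := by
  obtain ⟨a, ha, b, hb, hab⟩ := hzeros.nontrivial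
  simp only [mem_ofPred_eq, hf] at ha hb
  have hc₁ : c₁ ≠ 0 := by
    rintro rfl
    exact hc ⟨rfl, by simpa [exp_ne_zero] using ha⟩
  have hC : 2 * I * c₁ * exp (I * η * a) ≠ 0 := by simp [hc₁, exp_ne_zero]
  rw [exp_add_exp_eq_sin_of_zero ha, mul_eq_zero, or_iff_right hC, sin_eq_zero_iff] at hb
  obtain ⟨k, hk⟩ := hb
  have hba : (b : ℂ) - a ≠ 0 := by
    rw [sub_ne_zero]; exact_mod_cast hab.symm
  obtain ⟨t, rfl⟩ : ∃ t : ℝ, (t : ℂ) = η := by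
    refine ⟨k * Real.pi / (b - a), ?_⟩
    push_cast
    rw [div_eq_iff hba, ← hk]
    ring
  have ht : t ≠ 0 := by exact_mod_cast hη
  refine ⟨?_, t, _, t * a, rfl, hC, fun z => ?_⟩
  · rw [← ofReal_pow, ofReal_im, ofReal_re]
    exact ⟨rfl, by positivity⟩
  · rw [hf, exp_add_exp_eq_sin_of_zero ha, ofReal_mul]
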